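/- arXiv:1701.03626 — 2 statements merged into one kernel-verified Lean document; each statement's English description precedes it below -/
import Mathlib

section
/- Let μ ∈ ℂ with Re μ < 1/2, let ν ∈ (−1/2, −Re μ), and let f : (0,∞) → ℂ be measurable with ‖f‖_{1−ν,1} = ∫₀^∞ |f(y)| y^{−ν} dy < ∞. Then for every τ ∈ ℝ the integral (F_μ f)(τ) = ∫₀^∞ Φ_τ(y) f(y) dy converges absolutely, τ ↦ (F_μ f)(τ) is a bounded continuous function on ℝ, and sup_{τ ∈ ℝ} |(F_μ f)(τ)| ≤ C_{μ,ν} ‖f‖_{1−ν,1}, where C_{μ,ν} = (2^{2ν−1}/(π√π)) B(ν+1/2, ν+1/2) ∫_{−∞}^∞ |Γ(ν+1/2+it)² Γ(−μ−ν−it) / Γ(1+ν+it−μ)| dt and B denotes the Euler Beta function. -/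
open MeasureTheory Set Complex

/-- The integrand of the Mellin–Barnes representation of the kernel `Φ_τ`. -/
noncomputable def Kker (μ : ℂ) (τ : ℝ) (s : ℂ) : ℂ :=
  Complex.Gamma (s + 1/2 + Complex.I * (τ : ℂ)) *
    Complex.Gamma (s + 1/2 - Complex.I * (τ : ℂ)) *
    Complex.Gamma (s + 1/2) * Complex.Gamma (-μ - s) /
    (Complex.Gamma (1 + s) * Complex.Gamma (1 + s - μ))

/-- The kernel `Φ_τ(x)`, given as a Mellin–Barnes integral along the line `Re s = γ`. -/
noncomputable def Phi (μ : ℂ) (γ τ x : ℝ) : ℂ :=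
  (1 / (2 * Real.pi)) •
    ∫ t : ℝ, Kker μ τ ((γ : ℂ) + (t : ℂ) * Complex.I) *
      (x : ℂ) ^ (-((γ : ℂ) + (t : ℂ) * Complex.I))

/-- The constant `C_{μ,ν}` with the Euler Beta function `B(a,b) = Γ(a)Γ(b)/Γ(a+b)`. -/
noncomputable def Cconst (μ : ℂ) (ν : ℝ) : ℝ :=
  (2 : ℝ) ^ (2 * ν - 1) / (Real.pi * Real.sqrt Real.pi) *
    (Real.Gamma (ν + 1/2) * Real.Gamma (ν + 1/2) / Real.Gamma (ν + 1/2 + (ν + 1/2))) *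
    ∫ t : ℝ, ‖Complex.Gamma ((ν : ℂ) + 1/2 + (t : ℂ) * Complex.I) ^ 2 *
      Complex.Gamma (-μ - (ν : ℂ) - (t : ℂ) * Complex.I) /
      Complex.Gamma (1 + (ν : ℂ) + (t : ℂ) * Complex.I - μ)‖

/-- The index transform `(F_μ f)(τ) = ∫₀^∞ Φ_τ(y) f(y) dy`. -/
noncomputable def Fmu (μ : ℂ) (γ : ℝ) (f : ℝ → ℂ) (τ : ℝ) : ℂ :=
  ∫ y in Set.Ioi (0 : ℝ), Phi μ γ τ y * f y

open ProbabilityTheory (beta beta_pos beta_eq_betaIntegralReal)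

theorem norm_betaIntegral_le {u v : ℂ} (hu : 0 < u.re) (hv : 0 < v.re) :
    ‖betaIntegral u v‖ ≤ beta u.re v.re := by
  have hconv : IntervalIntegrable (fun x : ℝ =>
      (x : ℂ) ^ ((u.re : ℂ) - 1) * (1 - (x : ℂ)) ^ ((v.re : ℂ) - 1)) volume 0 1 :=
    betaIntegral_convergent (by simpa using hu) (by simpa using hv)
  have hnorm : ∀ x ∈ Ioo (0 : ℝ) 1, ‖(x : ℂ) ^ (u - 1) * (1 - (x : ℂ)) ^ (v - 1)‖ =
      ((x : ℂ) ^ ((u.re : ℂ) - 1) * (1 - (x : ℂ)) ^ ((v.re : ℂ) - 1)).re := by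
    intro x hx
    have hx' : 0 < 1 - x := by linarith [hx.2]
    have e1 : (x : ℂ) ^ ((u.re : ℂ) - 1) = ((x ^ (u.re - 1) : ℝ) : ℂ) := by
      rw [ofReal_cpow hx.1.le]; push_cast; rfl
    have e2 : (1 - (x : ℂ)) ^ ((v.re : ℂ) - 1) = (((1 - x) ^ (v.re - 1) : ℝ) : ℂ) := by
      rw [ofReal_cpow hx'.le]; push_cast; rfl
    rw [e1, e2, ← ofReal_mul, ofReal_re, norm_mul, norm_cpow_eq_rpow_re_of_pos hx.1,
      show (1 - (x : ℂ)) = ((1 - x : ℝ) : ℂ) by push_cast; rfl,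
      norm_cpow_eq_rpow_re_of_pos hx']
    simp
  rw [beta_eq_betaIntegralReal _ _ hu hv]
  unfold betaIntegral
  rw [intervalIntegral.integral_of_le zero_le_one, intervalIntegral.integral_of_le zero_le_one,
    integral_Ioc_eq_integral_Ioo, integral_Ioc_eq_integral_Ioo]
  refine (norm_integral_le_integral_norm _).trans (le_of_eq ?_)
  rw [setIntegral_congr_fun measurableSet_Ioo hnorm]
  rw [intervalIntegrable_iff_integrableOn_Ioo_of_le zero_le_one] at hconv
  exact integral_re (𝕜 := ℂ) hconv

theorem norm_Gamma_mul_Gamma_le {u v : ℂ} (hu : 0 < u.re) (hv : 0 < v.re) :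
    ‖Gamma u * Gamma v‖ ≤ ‖Gamma (u + v)‖ * beta u.re v.re := by
  rw [Gamma_mul_Gamma_eq_betaIntegral hu hv, norm_mul]
  gcongr
  exact norm_betaIntegral_le hu hv

theorem norm_Gamma_mul_Gamma_div_le {s : ℂ} (hs : -(1 / 2) < s.re) (τ : ℝ) :
    ‖Gamma (s + 1/2 + I * τ) * Gamma (s + 1/2 - I * τ) / Gamma (1 + s)‖ ≤
      2 ^ (2 * s.re) / √Real.pi * beta (s.re + 1/2) (s.re + 1/2) * ‖Gamma (s + 1/2)‖ := by
  have h1 : (s + 1/2 + I * τ).re = s.re + 1/2 := by simp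
  have h2 : (s + 1/2 - I * τ).re = s.re + 1/2 := by simp
  have hpos : 0 < s.re + 1/2 := by linarith
  have hne : Gamma (1 + s) ≠ 0 := Gamma_ne_zero_of_re_pos (by simp; linarith)
  have hbound := norm_Gamma_mul_Gamma_le (h1 ▸ hpos) (h2 ▸ hpos)
  rw [h1, h2, show s + 1/2 + I * τ + (s + 1/2 - I * τ) = 2 * (s + 1/2) by ring] at hbound
  have hdup := Gamma_mul_Gamma_add_half (s + 1/2)
  rw [show s + 1/2 + 1/2 = 1 + s by ring] at hdup
  have hdup' := congrArg norm hdup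
  have hpow : ‖(2 : ℂ) ^ (1 - 2 * (s + 1/2))‖ = (2 ^ (2 * s.re))⁻¹ := by
    rw [show (2 : ℂ) = ((2 : ℝ) : ℂ) by norm_num, norm_cpow_eq_rpow_re_of_pos two_pos,
      ← Real.rpow_neg two_pos.le]
    congr 1
    simp
    ring
  rw [norm_mul, norm_mul, norm_mul, hpow, Complex.norm_of_nonneg (Real.sqrt_nonneg _)] at hdup'
  have hπ : 0 < √Real.pi := Real.sqrt_pos.2 Real.pi_pos
  have hp2 : (0 : ℝ) < 2 ^ (2 * s.re) := Real.rpow_pos_of_pos two_pos _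
  have hG : ‖Gamma (2 * (s + 1/2))‖ =
      2 ^ (2 * s.re) / √Real.pi * (‖Gamma (s + 1/2)‖ * ‖Gamma (1 + s)‖) := by
    rw [hdup']
    field_simp
  rw [norm_div, div_le_iff₀ (norm_pos_iff.2 hne)]
  refine hbound.trans (le_of_eq ?_)
  rw [hG]
  ring

theorem norm_Gamma_sq_mul_Gamma_div_le {u v : ℂ} (hu : 0 < u.re) (hv : 0 < v.re) :
    ‖Gamma u ^ 2 * Gamma v / Gamma (u + (u + v))‖ ≤
      beta u.re (u + v).re / ‖Gamma (u + v)‖ *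
        (‖Gamma (u + v + 2)‖ * beta (u.re + 1) (v.re + 1)) * (‖u‖⁻¹ * ‖v‖⁻¹) := by
  have huv : 0 < (u + v).re := by simp; linarith
  have hu0 : u ≠ 0 := by rintro rfl; simp at hu
  have hv0 : v ≠ 0 := by rintro rfl; simp at hv
  have hne : 0 < ‖Gamma (u + v)‖ := norm_pos_iff.2 (Gamma_ne_zero_of_re_pos huv)
  have hne' : 0 < ‖Gamma (u + (u + v))‖ :=
    norm_pos_iff.2 (Gamma_ne_zero_of_re_pos (by rw [add_re]; linarith))
  have h1 : ‖Gamma u / Gamma (u + (u + v))‖ ≤ beta u.re (u + v).re / ‖Gamma (u + v)‖ := by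
    rw [norm_div, div_le_div_iff₀ hne' hne, ← norm_mul, mul_comm (beta _ _)]
    exact norm_Gamma_mul_Gamma_le hu huv
  have h2 : ‖Gamma u * Gamma v‖ ≤
      (‖Gamma (u + v + 2)‖ * beta (u.re + 1) (v.re + 1)) * (‖u‖⁻¹ * ‖v‖⁻¹) := by
    have h := norm_Gamma_mul_Gamma_le (u := u + 1) (v := v + 1) (by simp; linarith)
      (by simp; linarith)
    rw [Gamma_add_one u hu0, Gamma_add_one v hv0,
      show u + 1 + (v + 1) = u + v + 2 by ring] at h
    simp only [add_re, one_re] at h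
    rw [← mul_inv, ← div_eq_mul_inv, le_div_iff₀ (by positivity)]
    refine le_trans (le_of_eq ?_) h
    simp only [norm_mul]
    ring
  rw [show Gamma u ^ 2 * Gamma v / Gamma (u + (u + v)) =
    (Gamma u / Gamma (u + (u + v))) * (Gamma u * Gamma v) by ring, norm_mul, mul_assoc]
  exact mul_le_mul h1 h2 (norm_nonneg _) ((norm_nonneg _).trans h1)

theorem integrable_inv_sq_add_sq {a : ℝ} (ha : 0 < a) :
    Integrable fun t : ℝ => (a ^ 2 + t ^ 2)⁻¹ := by
  have h := (integrable_inv_one_add_sq.comp_mul_left' (inv_ne_zero ha.ne')).const_mul (a ^ 2)⁻¹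
  refine h.congr (Filter.Eventually.of_forall fun t => ?_)
  simp only
  rw [← mul_inv]
  congr 1
  field_simp

theorem continuous_Gamma_comp {X : Type*} [TopologicalSpace X] {g : X → ℂ} (hg : Continuous g)
    (hpos : ∀ x, 0 < (g x).re) : Continuous fun x => Gamma (g x) := by
  refine continuous_iff_continuousAt.2 fun x => ?_
  refine ContinuousAt.comp (f := g) (g := Gamma)
    (differentiableAt_Gamma _ fun m h => ?_).continuousAt hg.continuousAt
  have := hpos x
  rw [h] at this
  simp at this
  exact absurd this (not_lt.2 m.cast_nonneg)

/-- The integrand, before taking norms, of the constant `Cconst μ ν`. -/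
noncomputable def majorant (μ : ℂ) (ν t : ℝ) : ℂ :=
  Gamma ((ν : ℂ) + 1/2 + (t : ℂ) * I) ^ 2 * Gamma (-μ - (ν : ℂ) - (t : ℂ) * I) /
    Gamma (1 + (ν : ℂ) + (t : ℂ) * I - μ)

theorem continuous_majorant {μ : ℂ} {ν : ℝ} (hν : ν ∈ Ioo (-(1/2) : ℝ) (-μ.re)) :
    Continuous (majorant μ ν) := by
  obtain ⟨h1, h2⟩ := hν
  have hd : ∀ t : ℝ, 0 < (1 + (ν : ℂ) + (t : ℂ) * I - μ).re := fun t => by simp; linarith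
  unfold majorant
  refine Continuous.div (Continuous.mul (Continuous.pow ?_ 2) ?_) ?_
    fun t => Gamma_ne_zero_of_re_pos (hd t)
  · exact continuous_Gamma_comp (by fun_prop) fun t => by simp; linarith
  · exact continuous_Gamma_comp (by fun_prop) fun t => by simp; linarith
  · exact continuous_Gamma_comp (by fun_prop) hd

theorem integrable_norm_majorant {μ : ℂ} {ν : ℝ} (hν : ν ∈ Ioo (-(1/2) : ℝ) (-μ.re)) :
    Integrable fun t : ℝ => ‖majorant μ ν t‖ := by
  have hcont := (continuous_majorant hν).norm
  obtain ⟨h1, h2⟩ := hν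
  have ha : 0 < ν + 1/2 := by linarith
  have hb : 0 < -μ.re - ν := by linarith
  set K : ℝ := beta (ν + 1/2) (1/2 - μ.re) / ‖Gamma (1/2 - μ)‖ *
    (‖Gamma (1/2 - μ + 2)‖ * beta (ν + 1/2 + 1) (-μ.re - ν + 1)) with hK
  have hK0 : 0 ≤ K := by
    have := beta_pos ha (show 0 < 1/2 - μ.re by linarith)
    have := beta_pos (show 0 < ν + 1/2 + 1 by linarith) (show 0 < -μ.re - ν + 1 by linarith)
    positivity
  have hint : Integrable fun t : ℝ => K * (((ν + 1/2) ^ 2 + t ^ 2)⁻¹ +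
      ((-μ.re - ν) ^ 2 + (t + μ.im) ^ 2)⁻¹) :=
    ((integrable_inv_sq_add_sq ha).add
      ((integrable_inv_sq_add_sq hb).comp_add_right μ.im)).const_mul K
  refine hint.mono' hcont.aestronglyMeasurable (Filter.Eventually.of_forall fun t => ?_)
  rw [norm_norm]
  have hu : ((ν : ℂ) + 1/2 + (t : ℂ) * I).re = ν + 1/2 := by simp
  have hv : (-μ - (ν : ℂ) - (t : ℂ) * I).re = -μ.re - ν := by simp
  have h := norm_Gamma_sq_mul_Gamma_div_le (hu ▸ ha) (hv ▸ hb)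
  have huv : (ν : ℂ) + 1/2 + (t : ℂ) * I + (-μ - (ν : ℂ) - (t : ℂ) * I) = 1/2 - μ := by ring
  have huv' : ((1 : ℂ)/2 - μ).re = 1/2 - μ.re := by simp
  rw [huv, hu, hv, huv',
    show (ν : ℂ) + 1/2 + (t : ℂ) * I + (1/2 - μ) = 1 + (ν : ℂ) + (t : ℂ) * I - μ by ring] at h
  refine h.trans (mul_le_mul_of_nonneg_left ?_ hK0)
  have nu : ‖(ν : ℂ) + 1/2 + (t : ℂ) * I‖ ^ 2 = (ν + 1/2) ^ 2 + t ^ 2 := by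
    rw [← normSq_eq_norm_sq, normSq_apply]; simp; ring
  have nv : ‖-μ - (ν : ℂ) - (t : ℂ) * I‖ ^ 2 = (-μ.re - ν) ^ 2 + (t + μ.im) ^ 2 := by
    rw [← normSq_eq_norm_sq, normSq_apply]; simp; ring
  rw [← nu, ← nv, ← inv_pow, ← inv_pow]
  nlinarith [sq_nonneg (‖(ν : ℂ) + 1/2 + (t : ℂ) * I‖⁻¹ - ‖-μ - (ν : ℂ) - (t : ℂ) * I‖⁻¹),
    sq_nonneg ‖(ν : ℂ) + 1/2 + (t : ℂ) * I‖⁻¹, sq_nonneg ‖-μ - (ν : ℂ) - (t : ℂ) * I‖⁻¹]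

theorem norm_Kker_le {μ : ℂ} {ν : ℝ} (hν : ν ∈ Ioo (-(1/2) : ℝ) (-μ.re)) (τ t : ℝ) :
    ‖Kker μ τ ((ν : ℂ) + (t : ℂ) * I)‖ ≤
      2 ^ (2 * ν) / √Real.pi * beta (ν + 1/2) (ν + 1/2) * ‖majorant μ ν t‖ := by
  set s : ℂ := (ν : ℂ) + (t : ℂ) * I with hs
  have hre : s.re = ν := by simp [hs]
  have h := norm_Gamma_mul_Gamma_div_le (s := s) (by rw [hre]; linarith [hν.1]) τ
  rw [hre] at h
  have hm : majorant μ ν t =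
      Gamma (s + 1/2) * (Gamma (s + 1/2) * Gamma (-μ - s) / Gamma (1 + s - μ)) := by
    unfold majorant
    rw [show (ν : ℂ) + 1/2 + (t : ℂ) * I = s + 1/2 by rw [hs]; ring,
      show -μ - (ν : ℂ) - (t : ℂ) * I = -μ - s by rw [hs]; ring,
      show 1 + (ν : ℂ) + (t : ℂ) * I - μ = 1 + s - μ by rw [hs]; ring]
    ring
  have hk : Kker μ τ s = Gamma (s + 1/2 + I * τ) * Gamma (s + 1/2 - I * τ) / Gamma (1 + s) *
      (Gamma (s + 1/2) * Gamma (-μ - s) / Gamma (1 + s - μ)) := by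
    unfold Kker
    rw [div_mul_div_comm]
    ring
  rw [hk, hm, norm_mul, norm_mul, ← mul_assoc]
  exact mul_le_mul_of_nonneg_right h (norm_nonneg _)

theorem continuous_Kker {μ : ℂ} {ν : ℝ} (hν : ν ∈ Ioo (-(1/2) : ℝ) (-μ.re)) :
    Continuous fun p : ℝ × ℝ => Kker μ p.1 ((ν : ℂ) + (p.2 : ℂ) * I) := by
  obtain ⟨h1, h2⟩ := hν
  have hd : ∀ p : ℝ × ℝ, 0 < (1 + ((ν : ℂ) + (p.2 : ℂ) * I)).re := fun p => by simp; linarith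
  have hd' : ∀ p : ℝ × ℝ, 0 < (1 + ((ν : ℂ) + (p.2 : ℂ) * I) - μ).re :=
    fun p => by simp; linarith
  unfold Kker
  refine Continuous.div (((Continuous.mul ?_ ?_).mul ?_).mul ?_) (Continuous.mul ?_ ?_) fun p =>
    mul_ne_zero (Gamma_ne_zero_of_re_pos (hd p)) (Gamma_ne_zero_of_re_pos (hd' p))
  · exact continuous_Gamma_comp (by fun_prop) fun p => by simp; linarith
  · exact continuous_Gamma_comp (by fun_prop) fun p => by simp; linarith
  · exact continuous_Gamma_comp (by fun_prop) fun p => by simp; linarith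
  · exact continuous_Gamma_comp (by fun_prop) fun p => by simp; linarith
  · exact continuous_Gamma_comp (by fun_prop) hd
  · exact continuous_Gamma_comp (by fun_prop) hd'

theorem measurable_Phi_integrand {μ : ℂ} {ν : ℝ} (hν : ν ∈ Ioo (-(1/2) : ℝ) (-μ.re)) (τ : ℝ) :
    Measurable fun p : ℝ × ℝ => Kker μ τ ((ν : ℂ) + (p.2 : ℂ) * I) *
      (p.1 : ℂ) ^ (-((ν : ℂ) + (p.2 : ℂ) * I)) := by
  have h1 : Continuous fun p : ℝ × ℝ => Kker μ τ ((ν : ℂ) + (p.2 : ℂ) * I) :=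
    (continuous_Kker hν).comp (g := fun p : ℝ × ℝ => Kker μ p.1 ((ν : ℂ) + (p.2 : ℂ) * I))
      (f := fun p : ℝ × ℝ => (τ, p.2)) (by fun_prop)
  have h2 : Measurable fun p : ℝ × ℝ => (p.1 : ℂ) ^ (-((ν : ℂ) + (p.2 : ℂ) * I)) :=
    Measurable.pow (by fun_prop) (by fun_prop)
  exact h1.measurable.mul h2

theorem norm_Phi_integrand_le {μ : ℂ} {ν : ℝ} (hν : ν ∈ Ioo (-(1/2) : ℝ) (-μ.re)) (τ t : ℝ)
    {x : ℝ} (hx : 0 < x) :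
    ‖Kker μ τ ((ν : ℂ) + (t : ℂ) * I) * (x : ℂ) ^ (-((ν : ℂ) + (t : ℂ) * I))‖ ≤
      2 ^ (2 * ν) / √Real.pi * beta (ν + 1/2) (ν + 1/2) * ‖majorant μ ν t‖ * x ^ (-ν) := by
  rw [norm_mul, norm_cpow_eq_rpow_re_of_pos hx]
  have : (-((ν : ℂ) + (t : ℂ) * I)).re = -ν := by simp
  rw [this]
  gcongr
  exact norm_Kker_le hν τ t

theorem measurable_Phi {μ : ℂ} {ν : ℝ} (hν : ν ∈ Ioo (-(1/2) : ℝ) (-μ.re)) (τ : ℝ) :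
    Measurable (Phi μ ν τ) := by
  have h := (measurable_Phi_integrand hν τ).stronglyMeasurable.integral_prod_right'
    (ν := (volume : Measure ℝ))
  exact h.measurable.const_smul (1 / (2 * Real.pi))

theorem norm_Phi_le {μ : ℂ} {ν : ℝ} (hν : ν ∈ Ioo (-(1/2) : ℝ) (-μ.re)) (τ : ℝ)
    {x : ℝ} (hx : 0 < x) : ‖Phi μ ν τ x‖ ≤ Cconst μ ν * x ^ (-ν) := by
  have h := norm_integral_le_of_norm_le
    (((integrable_norm_majorant hν).const_mul
      (2 ^ (2 * ν) / √Real.pi * beta (ν + 1/2) (ν + 1/2))).mul_const (x ^ (-ν)))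
    (Filter.Eventually.of_forall fun t => norm_Phi_integrand_le hν τ t hx)
  rw [integral_mul_const, integral_const_mul] at h
  have hC : Cconst μ ν = 1 / (2 * Real.pi) *
      (2 ^ (2 * ν) / √Real.pi * beta (ν + 1/2) (ν + 1/2) * ∫ t : ℝ, ‖majorant μ ν t‖) := by
    unfold Cconst beta majorant
    rw [Real.rpow_sub two_pos, Real.rpow_one]
    ring
  unfold Phi
  rw [norm_smul, Real.norm_of_nonneg (by positivity), hC, mul_assoc]
  gcongr

theorem continuous_Phi {μ : ℂ} {ν : ℝ} (hν : ν ∈ Ioo (-(1/2) : ℝ) (-μ.re))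
    {x : ℝ} (hx : 0 < x) : Continuous fun τ => Phi μ ν τ x := by
  unfold Phi
  refine Continuous.const_smul (M := ℝ) (continuous_of_dominated (fun τ => ?_)
    (fun τ => Filter.Eventually.of_forall fun t => norm_Phi_integrand_le hν τ t hx)
    (((integrable_norm_majorant hν).const_mul _).mul_const _)
    (Filter.Eventually.of_forall fun t => ?_)) _
  · exact ((measurable_Phi_integrand hν τ).comp measurable_prodMk_left).aestronglyMeasurable
  · exact ((continuous_Kker hν).comp (continuous_id.prodMk continuous_const)).mul continuous_const

theorem stmt4 (μ : ℂ) (hμ : μ.re < 1/2) (ν : ℝ)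
    (hν : ν ∈ Set.Ioo (-(1/2) : ℝ) (-μ.re))
    (f : ℝ → ℂ) (hfm : AEStronglyMeasurable f (volume.restrict (Set.Ioi (0 : ℝ))))
    (hf : IntegrableOn (fun y : ℝ => ‖f y‖ * y ^ (-ν)) (Set.Ioi (0 : ℝ))) :
    (∀ τ : ℝ, IntegrableOn (fun y : ℝ => Phi μ ν τ y * f y) (Set.Ioi (0 : ℝ))) ∧
    Continuous (Fmu μ ν f) ∧
    (∀ τ : ℝ, ‖Fmu μ ν f τ‖ ≤
      Cconst μ ν * ∫ y in Set.Ioi (0 : ℝ), ‖f y‖ * y ^ (-ν)) := by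
  have hmeas : ∀ τ : ℝ, AEStronglyMeasurable (fun y : ℝ => Phi μ ν τ y * f y)
      (volume.restrict (Ioi (0 : ℝ))) :=
    fun τ => (measurable_Phi hν τ).aestronglyMeasurable.mul hfm
  have hbound : ∀ τ : ℝ, ∀ᵐ y ∂(volume.restrict (Ioi (0 : ℝ))),
      ‖Phi μ ν τ y * f y‖ ≤ Cconst μ ν * (‖f y‖ * y ^ (-ν)) := by
    intro τ
    filter_upwards [ae_restrict_mem measurableSet_Ioi] with y hy
    rw [norm_mul, mul_comm ‖f y‖, ← mul_assoc]
    exact mul_le_mul_of_nonneg_right (norm_Phi_le hν τ hy) (norm_nonneg _)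
  have hint : Integrable (fun y : ℝ => Cconst μ ν * (‖f y‖ * y ^ (-ν)))
      (volume.restrict (Ioi (0 : ℝ))) := hf.const_mul _
  refine ⟨fun τ => hint.mono' (hmeas τ) (hbound τ), ?_, fun τ => ?_⟩
  · unfold Fmu
    refine continuous_of_dominated hmeas hbound hint ?_
    filter_upwards [ae_restrict_mem measurableSet_Ioi] with y hy
    exact (continuous_Phi hν hy).mul continuous_const
  · rw [← integral_const_mul]
    exact norm_integral_le_of_norm_le hint (hbound τ)
end

section
/- Let μ ∈ ℂ with Re μ < 1/2, let ν ∈ (−1/2, −Re μ), and let f : (0,∞) → ℂ be measurable with ∫₀^∞ |f(y)| y^{−ν} dy < ∞. Then the index transform (F_μ f)(τ) = ∫₀^∞ Φ_τ(y) f(y) dy tends to 0 as |τ| → ∞. -/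
open MeasureTheory Set Complex Filter

lemma integrableOn_rpow_mul_exp_neg_mul {s b : ℝ} (hs : -1 < s) (hb : 0 < b) :
    IntegrableOn (fun x : ℝ => x ^ s * Real.exp (-(b * x))) (Ioi 0) := by
  simpa using integrableOn_rpow_mul_exp_neg_mul_rpow (p := 1) hs one_pos hb

lemma differentiableAt_laplace_cpow {a r : ℂ} (ha : 0 < a.re) (hr : 0 < r.re) :
    DifferentiableAt ℂ
      (fun z : ℂ => ∫ t in Ioi (0 : ℝ), (t : ℂ) ^ (a - 1) * Complex.exp (-(z * t))) r := by
  have hmeas : ∀ z : ℂ, AEStronglyMeasurable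
      (fun t : ℝ => (t : ℂ) ^ (a - 1) * Complex.exp (-(z * t)))
      (volume.restrict (Ioi (0 : ℝ))) := fun z =>
    ContinuousOn.aestronglyMeasurable (fun t ht =>
      ((Complex.continuousAt_ofReal_cpow_const t (a - 1) (.inr (ne_of_gt ht))).mul
        (by fun_prop)).continuousWithinAt) measurableSet_Ioi
  have hnorm : ∀ z : ℂ, ∀ t : ℝ, 0 < t → ‖(t : ℂ) ^ (a - 1) * Complex.exp (-(z * t))‖ =
      t ^ (a.re - 1) * Real.exp (-(z.re * t)) := by
    intro z t ht
    rw [norm_mul, Complex.norm_cpow_eq_rpow_re_of_pos ht, Complex.norm_exp, neg_re,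
      Complex.re_mul_ofReal]
    simp
  refine ((hasDerivAt_integral_of_dominated_loc_of_deriv_le
    (bound := fun t : ℝ => t ^ a.re * Real.exp (-(r.re / 2 * t)))
    (F' := fun z t => (t : ℂ) ^ (a - 1) * Complex.exp (-(z * t)) * (-t))
    (Metric.ball_mem_nhds r (half_pos hr)) (.of_forall hmeas) ?_ ?_ ?_
    (integrableOn_rpow_mul_exp_neg_mul (by linarith) (half_pos hr)) ?_).2).differentiableAt
  · refine (integrableOn_rpow_mul_exp_neg_mul (s := a.re - 1) (by linarith) hr).mono' (hmeas r) ?_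
    exact (ae_restrict_iff' measurableSet_Ioi).mpr
      (ae_of_all _ fun t ht => (hnorm r t ht).le)
  · exact (hmeas r).mul (by fun_prop)
  · refine (ae_restrict_iff' measurableSet_Ioi).mpr (ae_of_all _ fun t ht z hz => ?_)
    have ht' : 0 < t := ht
    rw [norm_mul, hnorm z t ht, norm_neg, Complex.norm_real, Real.norm_of_nonneg ht'.le,
      mul_right_comm, ← Real.rpow_add_one ht'.ne', sub_add_cancel]
    have h1 := (abs_le.mp ((Complex.abs_re_le_norm (z - r)).trans
      (mem_ball_iff_norm.mp hz).le)).1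
    rw [sub_re] at h1
    gcongr
    linarith
  · refine ae_of_all _ fun t z _ => ?_
    have h : HasDerivAt (fun z : ℂ => -(z * t)) (-t) z := by
      simpa using ((hasDerivAt_id z).mul_const (t : ℂ)).fun_neg
    simpa [mul_assoc] using h.cexp.const_mul ((t : ℂ) ^ (a - 1))

/-- Euler's integral with a complex rate in the right half-plane. -/
lemma integral_cpow_mul_exp_neg_mul_Ioi_of_re_pos {a r : ℂ} (ha : 0 < a.re) (hr : 0 < r.re) :
    ∫ t in Ioi (0 : ℝ), (t : ℂ) ^ (a - 1) * Complex.exp (-(r * t)) =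
      (1 / r) ^ a * Complex.Gamma a := by
  have hopen : IsOpen {z : ℂ | 0 < z.re} := isOpen_lt continuous_const continuous_re
  have hF : AnalyticOnNhd ℂ
      (fun z : ℂ => ∫ t in Ioi (0 : ℝ), (t : ℂ) ^ (a - 1) * Complex.exp (-(z * t)))
      {z : ℂ | 0 < z.re} :=
    DifferentiableOn.analyticOnNhd
      (fun z hz => (differentiableAt_laplace_cpow ha hz).differentiableWithinAt) hopen
  have hG : AnalyticOnNhd ℂ (fun z : ℂ => (1 / z) ^ a * Complex.Gamma a)
      {z : ℂ | 0 < z.re} := by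
    refine DifferentiableOn.analyticOnNhd (fun z hz => ?_) hopen
    have hz0 : z ≠ 0 := fun h => by simp [h] at hz
    have hs : 1 / z ∈ slitPlane := by
      left
      rw [one_div, Complex.inv_re]
      exact div_pos hz (Complex.normSq_pos.mpr hz0)
    have h1 : DifferentiableAt ℂ (fun z : ℂ => 1 / z) z := by fun_prop (disch := exact hz0)
    exact ((h1.cpow_const hs).mul_const _).differentiableWithinAt
  refine hF.eqOn_of_preconnected_of_frequently_eq hG (convex_halfSpace_re_gt 0).isPreconnected
    (z₀ := 1) (by simp) ?_ hr
  have htend : Tendsto (fun n : ℕ => ((1 + 1 / ((n : ℝ) + 1) : ℝ) : ℂ)) atTop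
      (nhdsWithin 1 {1}ᶜ) := by
    refine tendsto_nhdsWithin_iff.mpr ⟨?_, .of_forall fun n => ?_⟩
    · have h := (tendsto_one_div_add_atTop_nhds_zero_nat (𝕜 := ℝ)).const_add 1
      rw [add_zero] at h
      have h' := (Complex.continuous_ofReal.tendsto 1).comp h
      rwa [Complex.ofReal_one] at h'
    · have : (0 : ℝ) < 1 / ((n : ℝ) + 1) := by positivity
      rw [mem_compl_singleton_iff]
      exact_mod_cast (lt_add_of_pos_right 1 this).ne'
  exact htend.frequently (Frequently.of_forall fun n =>
    Complex.integral_cpow_mul_exp_neg_mul_Ioi ha (by positivity))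

/-- Exponential decay of `Γ` on vertical lines, by rotating the ray of integration. -/
lemma exists_norm_Gamma_vertical_le (c : ℂ) (hc : 0 < c.re) {θ : ℝ} (h0 : 0 < θ)
    (h1 : θ < Real.pi / 2) :
    ∃ C : ℝ, 0 ≤ C ∧ ∀ t : ℝ, ‖Complex.Gamma (c + t * I)‖ ≤ C * Real.exp (-θ * |t|) := by
  have key : ∀ φ : ℝ, |φ| = θ → ∀ a : ℂ, 0 < a.re →
      Real.exp (φ * a.im) * ‖Complex.Gamma a‖ ≤
        ∫ x in Ioi (0 : ℝ), x ^ (a.re - 1) * Real.exp (-(Real.cos θ * x)) := by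
    intro φ hφ a ha
    have hcos : Real.cos φ = Real.cos θ := by rw [← hφ, Real.cos_abs]
    have hr : 0 < (Complex.exp (φ * I)).re := by
      rw [Complex.exp_ofReal_mul_I_re, hcos]
      exact Real.cos_pos_of_mem_Ioo ⟨by linarith, h1⟩
    have hb := abs_lt.mp (hφ.trans_lt h1)
    have hinv : 1 / Complex.exp (φ * I) = Complex.exp (((-φ : ℝ) : ℂ) * I) := by
      rw [one_div, ← Complex.exp_neg]; congr 1; push_cast; ring
    have harg : (1 / Complex.exp (φ * I)).arg = -φ := by
      rw [hinv, Complex.exp_mul_I, Complex.arg_cos_add_sin_mul_I]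
      constructor <;> linarith [Real.pi_pos]
    have hnorm : ‖(1 / Complex.exp (φ * I)) ^ a‖ = Real.exp (φ * a.im) := by
      rw [Complex.norm_cpow_of_ne_zero (by simp), harg]
      simp [Complex.norm_exp, ← Real.exp_neg]
    rw [← hnorm, ← norm_mul,
      ← integral_cpow_mul_exp_neg_mul_Ioi_of_re_pos (r := Complex.exp (φ * I)) ha hr]
    refine (norm_integral_le_integral_norm _).trans_eq ?_
    refine setIntegral_congr_fun measurableSet_Ioi fun x hx => ?_
    rw [mem_Ioi] at hx
    simp only [norm_mul, Complex.norm_exp]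
    rw [Complex.norm_cpow_eq_rpow_re_of_pos hx]
    have : (-(Complex.exp (φ * I) * (x : ℂ))).re = -(Real.cos θ * x) := by
      rw [neg_re, Complex.re_mul_ofReal, Complex.exp_ofReal_mul_I_re, hcos]
    rw [this]; simp
  set A := ∫ x in Ioi (0 : ℝ), x ^ (c.re - 1) * Real.exp (-(Real.cos θ * x)) with hA
  have hA0 : 0 ≤ A := setIntegral_nonneg measurableSet_Ioi fun x hx =>
    mul_nonneg (Real.rpow_nonneg (le_of_lt hx) _) (Real.exp_pos _).le
  refine ⟨A * Real.exp (θ * |c.im|), by positivity, fun t => ?_⟩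
  have hre : (c + t * I).re = c.re := by simp
  have him : (c + t * I).im = c.im + t := by simp
  have hk : Real.exp (θ * |c.im + t|) * ‖Complex.Gamma (c + t * I)‖ ≤ A := by
    rcases le_total 0 (c.im + t) with h | h
    · have := key θ (abs_of_pos h0) (c + t * I) (by rwa [hre])
      rw [hre, him, ← hA] at this
      rwa [abs_of_nonneg h]
    · have := key (-θ) (by rw [abs_neg, abs_of_pos h0]) (c + t * I) (by rwa [hre])
      rw [hre, him, ← hA] at this
      rwa [abs_of_nonpos h, mul_neg, ← neg_mul]
  have htri : |t| ≤ |c.im + t| + |c.im| := by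
    simpa using abs_sub (c.im + t) c.im
  calc ‖Complex.Gamma (c + t * I)‖
      = Real.exp (θ * |c.im + t|) * ‖Complex.Gamma (c + t * I)‖ *
          Real.exp (-(θ * |c.im + t|)) := by
        rw [mul_right_comm, ← Real.exp_add]; simp
    _ ≤ A * Real.exp (θ * |c.im| + -θ * |t|) := by
        gcongr
        nlinarith
    _ = _ := by rw [Real.exp_add, mul_assoc]

lemma norm_sin_le_exp_abs_im (z : ℂ) : ‖Complex.sin z‖ ≤ Real.exp |z.im| := by
  have h1 : ‖Complex.exp (-z * I)‖ ≤ Real.exp |z.im| := by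
    rw [Complex.norm_exp]; gcongr; simpa using le_abs_self z.im
  have h2 : ‖Complex.exp (z * I)‖ ≤ Real.exp |z.im| := by
    rw [Complex.norm_exp]; gcongr; simpa using neg_le_abs z.im
  rw [Complex.sin, norm_div, norm_mul, Complex.norm_I, Complex.norm_two, mul_one]
  linarith [norm_sub_le (Complex.exp (-z * I)) (Complex.exp (z * I))]

/-- Exponential growth bound for `1 / Γ` on vertical lines, with rate `π - θ` for any
`θ < π / 2`. -/
lemma exists_norm_inv_Gamma_vertical_le (c : ℂ) {θ : ℝ} (h0 : 0 < θ) (h1 : θ < Real.pi / 2) :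
    ∃ C : ℝ, 0 ≤ C ∧
      ∀ t : ℝ, ‖(Complex.Gamma (c + t * I))⁻¹‖ ≤ C * Real.exp ((Real.pi - θ) * |t|) := by
  have hpi := Real.pi_pos
  have step : ∀ n : ℕ, ∀ c : ℂ, c.re < 1 + n → ∃ C : ℝ, 0 ≤ C ∧
      ∀ t : ℝ, ‖(Complex.Gamma (c + t * I))⁻¹‖ ≤ C * Real.exp ((Real.pi - θ) * |t|) := by
    intro n
    induction n with
    | zero =>
      intro c hc
      obtain ⟨C, hC0, hC⟩ := exists_norm_Gamma_vertical_le (1 - c)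
        (by simpa using hc) h0 h1
      refine ⟨C / Real.pi * Real.exp (Real.pi * |c.im|), by positivity, fun t => ?_⟩
      have hG := hC (-t)
      rw [abs_neg] at hG
      have hw : (1 - c : ℂ) + ((-t : ℝ) : ℂ) * I = 1 - (c + t * I) := by push_cast; ring
      rw [hw] at hG
      have hinv : ‖(Complex.Gamma (c + t * I))⁻¹‖ ≤
          ‖Complex.Gamma (1 - (c + t * I))‖ * ‖Complex.sin (Real.pi * (c + t * I))‖ /
            Real.pi := by
        by_cases hz : Complex.Gamma (c + t * I) = 0
        · rw [hz, inv_zero, norm_zero]; positivity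
        · have hrefl := Complex.Gamma_mul_Gamma_one_sub (c + t * I)
          have hne : Complex.Gamma (1 - (c + t * I)) ≠ 0 :=
            Complex.Gamma_ne_zero_of_re_pos (by simpa using hc)
          have hs : Complex.sin (Real.pi * (c + t * I)) ≠ 0 := fun h => by
            rw [h, div_zero] at hrefl
            exact mul_ne_zero hz hne hrefl
          have hp : (Real.pi : ℂ) ≠ 0 := by exact_mod_cast hpi.ne'
          rw [eq_div_iff hs] at hrefl
          have : (Complex.Gamma (c + t * I))⁻¹ = Complex.Gamma (1 - (c + t * I)) *
              Complex.sin (Real.pi * (c + t * I)) / Real.pi := by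
            rw [inv_eq_iff_eq_inv, inv_div, eq_div_iff (mul_ne_zero hne hs), ← mul_assoc, hrefl]
          rw [this, norm_div, norm_mul, Complex.norm_real, Real.norm_of_nonneg hpi.le]
      have hs : ‖Complex.sin (Real.pi * (c + t * I))‖ ≤
          Real.exp (Real.pi * |c.im|) * Real.exp (Real.pi * |t|) := by
        refine (norm_sin_le_exp_abs_im _).trans ?_
        rw [← Real.exp_add]
        have : (Real.pi * (c + t * I) : ℂ).im = Real.pi * (c.im + t) := by simp
        rw [this, abs_mul, abs_of_pos hpi, ← mul_add]
        gcongr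
        exact abs_add_le _ _
      calc _ ≤ _ := hinv
        _ ≤ (C * Real.exp (-θ * |t|)) *
            (Real.exp (Real.pi * |c.im|) * Real.exp (Real.pi * |t|)) / Real.pi := by gcongr
        _ = _ := by
          have : (Real.pi - θ) * |t| = -θ * |t| + Real.pi * |t| := by ring
          rw [this, Real.exp_add]; ring
    | succ n ih =>
      intro c hc
      obtain ⟨C, hC0, hC⟩ := ih (c - 1) (by simp at hc ⊢; linarith)
      obtain ⟨M, hM⟩ :=
        (isCompact_Icc (a := -(1 + |c.im|)) (b := 1 + |c.im|)).exists_bound_of_continuousOn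
        (f := fun t : ℝ => (Complex.Gamma (c + t * I))⁻¹)
        ((Complex.differentiable_one_div_Gamma.continuous.comp
          (g := fun s : ℂ => (Complex.Gamma s)⁻¹) (by fun_prop : Continuous
            fun t : ℝ => c + t * I)).continuousOn)
      have hM0 : 0 ≤ M := (norm_nonneg _).trans
        (hM 0 ⟨by linarith [abs_nonneg c.im], by positivity⟩)
      have hexp : ∀ t : ℝ, 1 ≤ Real.exp ((Real.pi - θ) * |t|) := fun t =>
        Real.one_le_exp (mul_nonneg (by linarith) (abs_nonneg t))
      refine ⟨C + M, by positivity, fun t => ?_⟩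
      rw [add_mul]
      rcases le_or_gt 1 |c.im + t| with h | h
      · have hw1 : 1 ≤ ‖c - 1 + t * I‖ := by
          refine h.trans ?_
          simpa using Complex.abs_im_le_norm (c - 1 + t * I)
        have hw : c - 1 + t * I ≠ 0 := norm_pos_iff.mp (by linarith)
        have hG := Complex.Gamma_add_one _ hw
        rw [show c - 1 + t * I + 1 = c + t * I by ring] at hG
        rw [hG, mul_inv, norm_mul, norm_inv]
        have h2 := hC t
        have h3 : ‖c - 1 + t * I‖⁻¹ ≤ 1 := inv_le_one_of_one_le₀ hw1
        have h4 := mul_le_of_le_one_left (norm_nonneg (Complex.Gamma (c - 1 + t * I))⁻¹) h3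
        have h5 := mul_nonneg hM0 (Real.exp_pos ((Real.pi - θ) * |t|)).le
        linarith
      · have ht : |t| ≤ 1 + |c.im| := by
          have := abs_sub (c.im + t) c.im
          rw [add_sub_cancel_left] at this
          linarith
        have h2 := hM t (abs_le.mp ht)
        have h3 := mul_nonneg hC0 (Real.exp_pos ((Real.pi - θ) * |t|)).le
        have h4 := le_mul_of_one_le_right hM0 (hexp t)
        linarith
  obtain ⟨n, hn⟩ := exists_nat_gt c.re
  exact step n c (by linarith)

/-- Joint exponential decay of the Mellin–Barnes integrand in `t` and `τ`. -/
lemma exists_norm_Kker_le (μ : ℂ) {ν : ℝ} (hν : ν ∈ Set.Ioo (-(1/2) : ℝ) (-μ.re)) :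
    ∃ C : ℝ, 0 ≤ C ∧ ∀ τ t : ℝ, ‖Kker μ τ ((ν : ℂ) + (t : ℂ) * I)‖ ≤
      C * Real.exp (-|τ|) * Real.exp (-(Real.pi / 4) * |t|) := by
  have hpi := Real.pi_gt_three
  set θ : ℝ := 9 * Real.pi / 20 with hθ
  have h0 : 0 < θ := by positivity
  have h1 : θ < Real.pi / 2 := by linarith
  obtain ⟨A, hA0, hA⟩ := exists_norm_Gamma_vertical_le ((ν : ℂ) + 1 / 2)
    (by simp; linarith [hν.1]) h0 h1
  obtain ⟨B, hB0, hB⟩ := exists_norm_Gamma_vertical_le (-μ - ν)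
    (by simp; linarith [hν.2]) h0 h1
  obtain ⟨D, hD0, hD⟩ := exists_norm_inv_Gamma_vertical_le (1 + ν) h0 h1
  obtain ⟨E, hE0, hE⟩ := exists_norm_inv_Gamma_vertical_le (1 + ν - μ) h0 h1
  refine ⟨A * A * A * B * D * E, by positivity, fun τ t => ?_⟩
  have e1 : (ν : ℂ) + t * I + 1 / 2 + I * τ = ν + 1 / 2 + ((t + τ : ℝ) : ℂ) * I := by
    push_cast; ring
  have e2 : (ν : ℂ) + t * I + 1 / 2 - I * τ = ν + 1 / 2 + ((t - τ : ℝ) : ℂ) * I := by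
    push_cast; ring
  have e3 : (ν : ℂ) + t * I + 1 / 2 = ν + 1 / 2 + t * I := by ring
  have e4 : -μ - ((ν : ℂ) + t * I) = -μ - ν + ((-t : ℝ) : ℂ) * I := by push_cast; ring
  have e5 : 1 + ((ν : ℂ) + t * I) = 1 + ν + t * I := by ring
  have e6 : 1 + (ν : ℂ) + t * I - μ = 1 + ν - μ + t * I := by ring
  have hB' := hB (-t)
  rw [abs_neg] at hB'
  rw [Kker, e1, e2, e3, e4, e5, e6, div_eq_mul_inv, mul_inv]
  simp only [norm_mul]
  have hmax : |t| + |τ| ≤ |t + τ| + |t - τ| := by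
    rcases abs_cases t with h | h <;> rcases abs_cases τ with h' | h' <;>
      rcases abs_cases (t + τ) with h2 | h2 <;> rcases abs_cases (t - τ) with h3 | h3 <;>
      linarith
  calc _ ≤ A * Real.exp (-θ * |t + τ|) * (A * Real.exp (-θ * |t - τ|)) *
        (A * Real.exp (-θ * |t|)) * (B * Real.exp (-θ * |t|)) *
        (D * Real.exp ((Real.pi - θ) * |t|) * (E * Real.exp ((Real.pi - θ) * |t|))) := by
        gcongr
        · exact hA _
        · exact hA _
        · exact hA _
        · exact hD _
        · exact hE _
    _ = A * A * A * B * D * E * Real.exp (-θ * (|t + τ| + |t - τ|) + -θ * |t| + -θ * |t| +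
          (Real.pi - θ) * |t| + (Real.pi - θ) * |t|) := by
        rw [mul_add]; simp only [Real.exp_add]; ring
    _ ≤ A * A * A * B * D * E * Real.exp (-|τ| + -(Real.pi / 4) * |t|) := by
        refine mul_le_mul_of_nonneg_left (Real.exp_le_exp.mpr ?_) (by positivity)
        have h2 := mul_le_mul_of_nonneg_left hmax h0.le
        have h3 : |τ| ≤ θ * |τ| := le_mul_of_one_le_left (abs_nonneg _) (by linarith)
        have h4 : (5 * θ) * |t| = (9 * Real.pi / 4) * |t| := by rw [hθ]; ring
        linarith
    _ = _ := by rw [Real.exp_add, mul_assoc _ (Real.exp (-|τ|))]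

lemma integrable_exp_neg_mul_abs {a : ℝ} (ha : 0 < a) :
    Integrable fun t : ℝ => Real.exp (-a * |t|) := by
  rw [← integrableOn_univ, ← Iic_union_Ioi (a := (0 : ℝ)), integrableOn_union]
  constructor
  · refine (integrableOn_exp_mul_Iic ha 0).congr_fun (fun t ht => ?_) measurableSet_Iic
    simp [abs_of_nonpos (mem_Iic.mp ht)]
  · refine (integrableOn_exp_mul_Ioi (neg_neg_of_pos ha) 0).congr_fun (fun t ht => ?_)
      measurableSet_Ioi
    simp [abs_of_pos (mem_Ioi.mp ht)]

/-- Decay of the kernel in `τ`, with the power weight in `x`. -/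
lemma exists_norm_Phi_le (μ : ℂ) {ν : ℝ} (hν : ν ∈ Set.Ioo (-(1/2) : ℝ) (-μ.re)) :
    ∃ C : ℝ, ∀ τ x : ℝ, 0 < x → ‖Phi μ ν τ x‖ ≤ C * Real.exp (-|τ|) * x ^ (-ν) := by
  obtain ⟨C, hC0, hC⟩ := exists_norm_Kker_le μ hν
  have hint := integrable_exp_neg_mul_abs (a := Real.pi / 4) (by positivity)
  refine ⟨‖(1 / (2 * Real.pi) : ℝ)‖ * (C * ∫ t : ℝ, Real.exp (-(Real.pi / 4) * |t|)),
    fun τ x hx => ?_⟩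
  have hle : ‖∫ t : ℝ, Kker μ τ ((ν : ℂ) + (t : ℂ) * I) *
      (x : ℂ) ^ (-((ν : ℂ) + (t : ℂ) * I))‖ ≤
      ∫ t : ℝ, C * Real.exp (-|τ|) * x ^ (-ν) * Real.exp (-(Real.pi / 4) * |t|) := by
    refine norm_integral_le_of_norm_le (hint.const_mul _) (ae_of_all _ fun t => ?_)
    rw [norm_mul, Complex.norm_cpow_eq_rpow_re_of_pos hx]
    have : (-((ν : ℂ) + t * I)).re = -ν := by simp
    rw [this, mul_right_comm _ (x ^ (-ν))]
    gcongr
    exact hC τ t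
  rw [Phi, norm_smul]
  rw [integral_const_mul] at hle
  refine (mul_le_mul_of_nonneg_left hle (norm_nonneg _)).trans_eq ?_
  ring

/-- `(F_μ f)(τ) → 0` as `|τ| → ∞`. -/
theorem stmt5 (μ : ℂ) (hμ : μ.re < 1/2) (ν : ℝ)
    (hν : ν ∈ Set.Ioo (-(1/2) : ℝ) (-μ.re))
    (f : ℝ → ℂ) (hfm : AEStronglyMeasurable f (volume.restrict (Set.Ioi (0 : ℝ))))
    (hf : IntegrableOn (fun y : ℝ => ‖f y‖ * y ^ (-ν)) (Set.Ioi (0 : ℝ))) :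
    Tendsto (Fmu μ ν f) (Filter.cocompact ℝ) (nhds 0) := by
  obtain ⟨C, hC⟩ := exists_norm_Phi_le μ hν
  set J := ∫ y in Set.Ioi (0 : ℝ), ‖f y‖ * y ^ (-ν)
  refine squeeze_zero_norm (a := fun τ => C * Real.exp (-|τ|) * J) (fun τ => ?_) ?_
  · rw [Fmu, ← integral_const_mul]
    refine norm_integral_le_of_norm_le (hf.const_mul _)
      ((ae_restrict_iff' measurableSet_Ioi).mpr (ae_of_all _ fun y hy => ?_))
    rw [norm_mul]
    refine (mul_le_mul_of_nonneg_right (hC τ y hy) (norm_nonneg _)).trans_eq ?_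
    ring
  · have h : Tendsto (fun τ : ℝ => Real.exp (-|τ|)) (cocompact ℝ) (nhds 0) :=
      Real.tendsto_exp_neg_atTop_nhds_zero.comp (tendsto_norm_cocompact_atTop (E := ℝ))
    simpa using (h.const_mul C).mul_const J
end
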